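/- arXiv:1610.02430 — 6 statements merged into one kernel-verified Lean document; each statement's English description precedes it below -/
import Mathlib

section
/- Let P ⊆ ℝⁿ be a lattice polytope (all vertices in ℤⁿ) of dimension at most 3, and let Δ_β ⪯ Δ_α be faces of P with a common vertex v; translate so that v = 0. Let M_α (resp. M_β) be the subgroup of ℤⁿ generated by Δ_α ∩ ℤⁿ (resp. Δ_β ∩ ℤⁿ), and let L(Δ_β) be the ℝ-linear span of Δ_β. Then M_α ∩ L(Δ_β) = M_β; equivalently, the index i(Δ_α, Δ_β) := [M_α ∩ L(Δ_β) : M_β] equals 1. -/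
/-- Any lattice point in the span of lattice points `a, b` is in the group generated by the
lattice points of a convex set containing `0, a, b`. -/
lemma mem_closure_of_two {n : ℕ} {D : Set (Fin n → ℝ)} (hD : Convex ℝ D) (Λ : AddSubgroup (Fin n → ℝ))
    {a b x : Fin n → ℝ} (h0 : (0 : Fin n → ℝ) ∈ D) (ha : a ∈ D) (hb : b ∈ D)
    (haL : a ∈ Λ) (hbL : b ∈ Λ) (hxL : x ∈ Λ) (s t : ℝ) (hx : x = s • a + t • b) :
    x ∈ AddSubgroup.closure (D ∩ (Λ : Set (Fin n → ℝ))) := by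
  set G := AddSubgroup.closure (D ∩ (Λ : Set (Fin n → ℝ))) with hG
  have haG : a ∈ G := AddSubgroup.subset_closure ⟨ha, haL⟩
  have hbG : b ∈ G := AddSubgroup.subset_closure ⟨hb, hbL⟩
  have tri : ∀ u v : ℝ, 0 ≤ u → 0 ≤ v → u + v ≤ 1 → u • a + v • b ∈ D := by
    intro u v hu hv huv
    have := hD.sum_mem (t := Finset.univ) (w := ![u, v, 1 - u - v]) (z := ![a, b, 0])
      (by intro i _; fin_cases i <;> simp <;> linarith)
      (by simp [Fin.sum_univ_three])
      (by intro i _; fin_cases i <;> simp [ha, hb, h0])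
    simpa [Fin.sum_univ_three] using this
  have hfl : x = Int.fract s • a + Int.fract t • b + (⌊s⌋ • a + ⌊t⌋ • b) := by
    rw [hx]; ext i
    rw [← Int.cast_smul_eq_zsmul ℝ ⌊s⌋ a, ← Int.cast_smul_eq_zsmul ℝ ⌊t⌋ b]
    simp only [Pi.add_apply, Pi.smul_apply, smul_eq_mul, Int.fract]
    ring
  have hintG : ⌊s⌋ • a + ⌊t⌋ • b ∈ G := G.add_mem (G.zsmul_mem haG _) (G.zsmul_mem hbG _)
  have hintL : ⌊s⌋ • a + ⌊t⌋ • b ∈ Λ := Λ.add_mem (Λ.zsmul_mem haL _) (Λ.zsmul_mem hbL _)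
  have hyL : Int.fract s • a + Int.fract t • b ∈ Λ := by
    have := Λ.sub_mem hxL hintL
    rwa [hfl, add_sub_cancel_right] at this
  have s0 := Int.fract_nonneg s
  have t0 := Int.fract_nonneg t
  have s1 := (Int.fract_lt_one s).le
  have t1 := (Int.fract_lt_one t).le
  rw [hfl]
  refine G.add_mem ?_ hintG
  by_cases h : Int.fract s + Int.fract t ≤ 1
  · exact AddSubgroup.subset_closure ⟨tri _ _ s0 t0 h, hyL⟩
  · have e : a + b - (Int.fract s • a + Int.fract t • b)
        = (1 - Int.fract s) • a + (1 - Int.fract t) • b := by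
      simp only [sub_smul, one_smul]; abel
    have h2 : a + b - (Int.fract s • a + Int.fract t • b) ∈ G := by
      refine AddSubgroup.subset_closure ⟨?_, Λ.sub_mem (Λ.add_mem haL hbL) hyL⟩
      rw [e]
      exact tri _ _ (by linarith) (by linarith) (by linarith)
    have := G.sub_mem (G.add_mem haG hbG) h2
    rwa [sub_sub_cancel] at this

/-- A finite-dimensional span of dimension at most two of a set containing zero is
spanned by two elements of the set. -/
lemma exists_two_span {n : ℕ} {W : Set (Fin n → ℝ)} (h0 : (0 : Fin n → ℝ) ∈ W)
    (h : Module.finrank ℝ (Submodule.span ℝ W) ≤ 2) :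
    ∃ a ∈ W, ∃ b ∈ W, ∀ x ∈ Submodule.span ℝ W, ∃ s t : ℝ, x = s • a + t • b := by
  obtain ⟨B, hBW, hsp, hli⟩ := exists_linearIndependent ℝ W
  have hfin : B.Finite := hli.setFinite
  have hc : B.ncard ≤ 2 := by
    have := hfin.fintype
    rw [← hsp, finrank_span_set_eq_card hli] at h
    rwa [Set.ncard_eq_toFinset_card']
  have key : ∃ a ∈ W, ∃ b ∈ W, B ⊆ {a, b} := by
    interval_cases hh : B.ncard
    · rw [Set.ncard_eq_zero hfin] at hh
      exact ⟨0, h0, 0, h0, by simp [hh]⟩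
    · obtain ⟨a, rfl⟩ := Set.ncard_eq_one.1 hh
      exact ⟨a, hBW (by simp), a, hBW (by simp), by simp⟩
    · obtain ⟨a, b, -, rfl⟩ := Set.ncard_eq_two.1 hh
      exact ⟨a, hBW (by simp), b, hBW (by simp), subset_rfl⟩
  obtain ⟨a, ha, b, hb, hB⟩ := key
  refine ⟨a, ha, b, hb, fun x hx => ?_⟩
  rw [← hsp] at hx
  obtain ⟨s, t, e⟩ := Submodule.mem_span_pair.1 (Submodule.span_mono hB hx)
  exact ⟨s, t, e.symm⟩

/-- The integer lattice as a subgroup. -/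
def intLat (n : ℕ) : AddSubgroup (Fin n → ℝ) where
  carrier := {x | ∀ j, ∃ m : ℤ, x j = (m : ℝ)}
  zero_mem' := fun _ => ⟨0, by simp⟩
  add_mem' := by
    intro a b ha hb j
    obtain ⟨p, hp⟩ := ha j
    obtain ⟨q, hq⟩ := hb j
    exact ⟨p + q, by simp [hp, hq]⟩
  neg_mem' := by
    intro a ha j
    obtain ⟨p, hp⟩ := ha j
    exact ⟨-p, by simp [hp]⟩

/-- for a lattice polytope `P ⊆ ℝⁿ` of dimension at most `3` and faces
`Δβ ⊆ Δα` of `P` with common vertex translated to the origin, the lattice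
`M_{α,β} = M_α ∩ L(Δβ)` equals `M_β`; i.e. the index `i(Δα, Δβ) = [M_{α,β} : M_β]`
is `1`.  Here `M_α` (resp. `M_β`) is the subgroup of `ℤⁿ` generated by the lattice
points of `Δα` (resp. `Δβ`) and `L(Δβ)` is the real linear span of `Δβ`. -/
theorem index_one_low_dimension (n : ℕ) (P Δα Δβ : Set (Fin n → ℝ))
    (V : Finset (Fin n → ℝ))
    (hV : (V : Set (Fin n → ℝ)) ⊆ {x | ∀ j, ∃ m : ℤ, x j = (m : ℝ)})
    (hP : P = convexHull ℝ (V : Set (Fin n → ℝ)))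
    (hdim : Module.finrank ℝ (affineSpan ℝ P).direction ≤ 3)
    (hα : IsExposed ℝ P Δα) (hβ : IsExposed ℝ P Δβ) (hβα : Δβ ⊆ Δα)
    (hvert : (0 : Fin n → ℝ) ∈ Set.extremePoints ℝ P)
    (hv0 : (0 : Fin n → ℝ) ∈ Δβ) :
    (AddSubgroup.closure (Δα ∩ {x | ∀ j, ∃ m : ℤ, x j = (m : ℝ)}) :
        Set (Fin n → ℝ)) ∩
        (Submodule.span ℝ Δβ : Set (Fin n → ℝ))
      = (AddSubgroup.closure (Δβ ∩ {x | ∀ j, ∃ m : ℤ, x j = (m : ℝ)}) :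
          Set (Fin n → ℝ)) := by
  have hLat : {x : Fin n → ℝ | ∀ j, ∃ m : ℤ, x j = (m : ℝ)}
      = (intLat n : Set (Fin n → ℝ)) := rfl
  rw [hLat] at hV ⊢
  have hVP : (V : Set (Fin n → ℝ)) ⊆ P := hP ▸ subset_convexHull ℝ _
  have hPc : Convex ℝ P := hP ▸ convex_convexHull ℝ _
  have hβc : Convex ℝ Δβ := hβ.convex hPc
  have h0P : (0 : Fin n → ℝ) ∈ P := hvert.1
  obtain ⟨l, hl⟩ := hβ ⟨0, hv0⟩
  have hmax : ∀ y ∈ P, l y ≤ 0 := by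
    have := hv0
    rw [hl] at this
    simpa using this.2
  have hmem : ∀ x, x ∈ Δβ ↔ x ∈ P ∧ l x = 0 := by
    intro x
    rw [hl]
    constructor
    · rintro ⟨hx, hx2⟩
      exact ⟨hx, le_antisymm (hmax x hx) (by simpa using hx2 0 h0P)⟩
    · rintro ⟨hx, hx2⟩
      exact ⟨hx, fun y hy => hx2 ▸ hmax y hy⟩
  apply Set.Subset.antisymm
  swap
  · intro x hx
    refine ⟨AddSubgroup.closure_mono (Set.inter_subset_inter_left _ hβα) hx, ?_⟩
    exact (AddSubgroup.closure_le (Submodule.span ℝ Δβ).toAddSubgroup).2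
      (fun y hy => Submodule.subset_span hy.1) hx
  rintro x ⟨hxα, hxs⟩
  have hxL : x ∈ intLat n :=
    (AddSubgroup.closure_le (intLat n)).2 (fun y hy => hy.2) hxα
  have hspanW : Submodule.span ℝ Δβ = Submodule.span ℝ (Δβ ∩ (intLat n : Set (Fin n → ℝ))) := by
    apply le_antisymm _ (Submodule.span_mono Set.inter_subset_left)
    rw [Submodule.span_le]
    intro y hy
    obtain ⟨hyP, hy0⟩ := (hmem y).1 hy
    rw [hP, Finset.mem_convexHull'] at hyP
    obtain ⟨w, hw0, -, hwy⟩ := hyP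
    have hsum : ∑ v ∈ V, w v * l v = 0 := by
      rw [← hwy, map_sum] at hy0
      simpa using hy0
    have hz := (Finset.sum_eq_zero_iff_of_nonpos (fun v hv =>
      mul_nonpos_of_nonneg_of_nonpos (hw0 v hv) (hmax v (hVP hv)))).1 hsum
    rw [← hwy]
    refine Submodule.sum_mem _ (fun v hv => ?_)
    rcases mul_eq_zero.1 (hz v hv) with h | h
    · simp [h]
    · exact Submodule.smul_mem _ _
        (Submodule.subset_span ⟨(hmem v).2 ⟨hVP hv, h⟩, hV hv⟩)
  by_cases hd : Module.finrank ℝ (Submodule.span ℝ Δβ) ≤ 2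
  · rw [hspanW] at hd hxs
    obtain ⟨a, ha, b, hb, hab⟩ := exists_two_span
      (W := Δβ ∩ (intLat n : Set (Fin n → ℝ))) ⟨hv0, (intLat n).zero_mem⟩ hd
    obtain ⟨s, t, hx⟩ := hab x hxs
    exact mem_closure_of_two hβc _ hv0 ha.1 hb.1 ha.2 hb.2 hxL s t hx
  · have hPD : P ⊆ (affineSpan ℝ P).direction := by
      intro y hy
      have := AffineSubspace.vsub_mem_direction (subset_affineSpan ℝ P hy)
        (subset_affineSpan ℝ P h0P)
      simpa using this
    have hle : Submodule.span ℝ Δβ ≤ (affineSpan ℝ P).direction :=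
      Submodule.span_le.2 (fun y hy => hPD ((hmem y).1 hy).1)
    have heq := Submodule.eq_of_le_of_finrank_le hle (by omega)
    have hker : Submodule.span ℝ Δβ ≤ LinearMap.ker (l : (Fin n → ℝ) →ₗ[ℝ] ℝ) :=
      Submodule.span_le.2 (fun y hy => by simpa using ((hmem y).1 hy).2)
    have hαβ : Δα ⊆ Δβ := by
      intro y hy
      have hyP := hα.subset hy
      refine (hmem y).2 ⟨hyP, ?_⟩
      have : y ∈ Submodule.span ℝ Δβ := by rw [heq]; exact hPD hyP
      simpa using hker this
    exact AddSubgroup.closure_mono (Set.inter_subset_inter_left _ hαβ) hxα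
end

section
/- Let P ⊆ ℝ² be a 2-dimensional lattice polytope and v a vertex of P such that P' := conv((P ∩ ℤ²) ∖ {v}) is still 2-dimensional. Let c be the number of interior lattice points of P that lie on the boundary of P'. Then Vol(P) = Vol(P') + 1 + c, where Vol denotes normalized area (twice Euclidean area). Equivalently, the local Euler obstruction of the torus-fixed point of the toric surface X_P corresponding to v, Eu(v) = 2 − Vol(P) + Vol(P'), equals 1 − c. -/
open MeasureTheory

/-- The standard lattice `ℤ²` inside `ℝ²`. -/
def Lat2 : Set (Fin 2 → ℝ) := {x | ∀ j, ∃ m : ℤ, x j = (m : ℝ)}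

namespace VEO

abbrev E2 := Fin 2 → ℝ

/-- the determinant of two plane vectors -/
def dt (x y : E2) : ℝ := x 0 * y 1 - x 1 * y 0

/-- Configuration: `S` is the set of all nonzero lattice points of `conv (S ∪ {0})`, and
`g` is positive on `S`. -/
structure Cfg (S : Finset E2) (g0 g1 : ℝ) : Prop where
  lat : ∀ s ∈ S, s ∈ Lat2
  full : ∀ x ∈ convexHull ℝ (insert 0 (S : Set E2)), x ∈ Lat2 → x ≠ 0 → x ∈ S
  pos : ∀ s ∈ S, 0 < g0 * s 0 + g1 * s 1
  ne : S.Nonempty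

/-- visible points -/
def Vis (S : Finset E2) (m : E2) : Prop :=
  m ∈ S ∧ ∀ t : ℝ, t < 1 → t • m ∉ convexHull ℝ (S : Set E2)

lemma convex_ge (α β c : ℝ) : Convex ℝ {x : E2 | c ≤ α * x 0 + β * x 1} := by
  apply convex_halfSpace_ge
  constructor
  · intro x y; simp; ring
  · intro x y; simp; ring

lemma convex_gt (α β c : ℝ) : Convex ℝ {x : E2 | c < α * x 0 + β * x 1} := by
  apply convex_halfSpace_gt
  constructor
  · intro x y; simp; ring
  · intro x y; simp; ring

lemma hull_ge {S : Set E2} (α β c : ℝ) (h : ∀ s ∈ S, c ≤ α * s 0 + β * s 1) :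
    ∀ x ∈ convexHull ℝ S, c ≤ α * x 0 + β * x 1 :=
  fun _ hx => convexHull_min (t := {x : E2 | c ≤ α * x 0 + β * x 1}) h (convex_ge α β c) hx

lemma hull_gt {S : Set E2} (α β c : ℝ) (h : ∀ s ∈ S, c < α * s 0 + β * s 1) :
    ∀ x ∈ convexHull ℝ S, c < α * x 0 + β * x 1 :=
  fun _ hx => convexHull_min (t := {x : E2 | c < α * x 0 + β * x 1}) h (convex_gt α β c) hx

variable {S : Finset E2} {g0 g1 : ℝ}

lemma Cfg.pos' (h : Cfg S g0 g1) : ∀ x ∈ convexHull ℝ (S : Set E2), 0 < g0 * x 0 + g1 * x 1 :=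
  hull_gt _ _ _ (fun s hs => h.pos s hs)

lemma sub_hull : convexHull ℝ (S : Set E2) ⊆ convexHull ℝ (insert 0 (S : Set E2)) :=
  convexHull_mono (Set.subset_insert _ _)

lemma zero_mem_hull : (0 : E2) ∈ convexHull ℝ (insert 0 (S : Set E2)) :=
  subset_convexHull ℝ _ (Set.mem_insert _ _)

lemma mem_hull {s : E2} (hs : s ∈ S) : s ∈ convexHull ℝ (S : Set E2) :=
  subset_convexHull ℝ _ hs

lemma Cfg.join (h : Cfg S g0 g1) {x : E2} (hx : x ∈ convexHull ℝ (insert 0 (S : Set E2))) :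
    ∃ l : ℝ, 0 ≤ l ∧ l ≤ 1 ∧ ∃ y ∈ convexHull ℝ (S : Set E2), x = l • y := by
  rw [convexHull_insert (by exact_mod_cast h.ne)] at hx
  rw [mem_convexJoin] at hx
  obtain ⟨z, hz, y, hy, hxy⟩ := hx
  rw [Set.mem_singleton_iff] at hz
  subst hz
  obtain ⟨a, b, ha, hb, hab, rfl⟩ := hxy
  exact ⟨b, hb, by linarith, y, hy, by simp⟩

lemma Cfg.nonneg (h : Cfg S g0 g1) {x : E2} (hx : x ∈ convexHull ℝ (insert 0 (S : Set E2))) :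
    0 ≤ g0 * x 0 + g1 * x 1 := by
  obtain ⟨l, hl, _, y, hy, rfl⟩ := h.join hx
  have := mul_nonneg hl (h.pos' y hy).le
  simp; linarith

/-- a point of the plane as linear combination in the convex hull -/
lemma smul_mem {x : E2} (hx : x ∈ convexHull ℝ (insert 0 (S : Set E2))) {t : ℝ} (h0 : 0 ≤ t)
    (h1 : t ≤ 1) : t • x ∈ convexHull ℝ (insert 0 (S : Set E2)) :=
  (convex_convexHull ℝ _).smul_mem_of_zero_mem zero_mem_hull hx ⟨h0, h1⟩

lemma tri_mem {p q : E2} (hp : p ∈ convexHull ℝ (insert 0 (S : Set E2)))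
    (hq : q ∈ convexHull ℝ (insert 0 (S : Set E2))) {a b : ℝ} (ha : 0 ≤ a) (hb : 0 ≤ b)
    (hab : a + b ≤ 1) : a • p + b • q ∈ convexHull ℝ (insert 0 (S : Set E2)) := by
  rcases (add_nonneg ha hb).eq_or_lt with h | h
  · have h1 : a = 0 := by linarith
    have h2 : b = 0 := by linarith
    simp [h1, h2, zero_mem_hull]
  · have := (convex_convexHull ℝ (insert 0 (S : Set E2))) hp hq (a := a / (a + b)) (b := b / (a + b))
      (by positivity) (by positivity) (by field_simp)
    have := smul_mem this h.le hab
    rw [smul_add, smul_smul, smul_smul, mul_div_cancel₀ _ h.ne', mul_div_cancel₀ _ h.ne'] at this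
    exact this

lemma plucker (x m y : E2) : dt x m • y + dt m y • x = dt x y • m := by
  ext i; fin_cases i <;> simp [dt] <;> ring

/-- The convex chain inequality. -/
lemma Vis.chain {m : E2} (hm : Vis S m) {x y : E2} (hx : x ∈ convexHull ℝ (S : Set E2))
    (hy : y ∈ convexHull ℝ (S : Set E2)) (hA : 0 ≤ dt x m) (hB : 0 ≤ dt m y)
    (hAB : 0 < dt x m + dt m y) : dt x m + dt m y ≤ dt x y := by
  by_contra hlt
  push Not at hlt
  apply hm.2 (dt x y / (dt x m + dt m y)) (by rw [div_lt_one hAB]; exact hlt)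
  have := (convex_convexHull ℝ (S : Set E2)) hy hx (a := dt x m / (dt x m + dt m y))
    (b := dt m y / (dt x m + dt m y)) (by positivity) (by positivity) (by field_simp)
  convert this using 1
  rw [div_eq_inv_mul, div_eq_inv_mul, div_eq_inv_mul, mul_smul, mul_smul, mul_smul, ← smul_add,
    plucker]

/-- gaps between consecutive visible points -/
lemma no_between {p q : E2} (hp : Vis S p) (hq : Vis S q) (hD : 0 < dt p q)
    (hF : ∀ m, Vis S m → 0 < dt p m → 0 < dt m q → False) :
    ∀ x ∈ convexHull ℝ (S : Set E2), dt p q ≤ dt x q + dt p x := by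
  have key : ∀ s ∈ S, dt p q ≤ dt s q + dt p s := by
    by_contra hcon
    push Not at hcon
    obtain ⟨s, hs, hlt⟩ := hcon
    obtain ⟨x, hxS, hx⟩ := S.exists_min_image (fun s => dt s q + dt p s) ⟨s, hs⟩
    have hxD : dt x q + dt p x < dt p q := lt_of_le_of_lt (hx s hs) hlt
    have h1 : 0 < dt p x := by
      by_contra h
      have h' : 0 ≤ dt x p := by simp only [dt] at h ⊢; linarith
      have := hp.chain (mem_hull hxS) (mem_hull hq.1) h' hD.le (by linarith)
      simp only [dt] at *; linarith
    have h2 : 0 < dt x q := by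
      by_contra h
      have h' : 0 ≤ dt q x := by simp only [dt] at h ⊢; linarith
      have := hq.chain (mem_hull hp.1) (mem_hull hxS) hD.le h' (by linarith)
      simp only [dt] at *; linarith
    refine hF x ⟨hxS, ?_⟩ h1 h2
    intro t ht htx
    have := hull_ge (S := (S : Set E2)) (q 1 - p 1) (p 0 - q 0) (dt x q + dt p x)
      (fun s hs => by have := hx s hs; simp only [dt] at *; linarith) _ htx
    have h3 : dt x q + dt p x ≤ t * (dt x q + dt p x) := by
      simp only [dt, Pi.smul_apply, smul_eq_mul] at *; linarith
    nlinarith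
  intro x hx
  have := hull_ge (S := (S : Set E2)) (q 1 - p 1) (p 0 - q 0) (dt p q)
      (fun s hs => by have := key s hs; simp only [dt] at *; linarith) _ hx
  simp only [dt] at *; linarith

lemma Vis.int {m : E2} (h : Cfg S g0 g1) (hm : Vis S m) :
    ∃ a b : ℤ, m 0 = a ∧ m 1 = b ∧ IsCoprime a b := by
  obtain ⟨a, ha⟩ := h.lat m hm.1 0
  obtain ⟨b, hb⟩ := h.lat m hm.1 1
  refine ⟨a, b, ha, hb, ?_⟩
  rw [Int.isCoprime_iff_gcd_eq_one]
  obtain ⟨a', ha'⟩ := Int.gcd_dvd_left a b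
  obtain ⟨b', hb'⟩ := Int.gcd_dvd_right a b
  have hne : Int.gcd a b ≠ 0 := by
    intro h0
    rw [Int.gcd_eq_zero_iff] at h0
    have := h.pos m hm.1
    rw [ha, hb, h0.1, h0.2] at this
    simp at this
  generalize Int.gcd a b = d at *
  by_contra hd1
  have hd : (1 : ℝ) < d := by
    have : 1 < d := by omega
    exact_mod_cast this
  have hmem := mem_hull hm.1
  have hx := smul_mem (sub_hull hmem) (t := (d : ℝ)⁻¹) (by positivity)
    (inv_le_one_of_one_le₀ hd.le)
  apply hm.2 (d : ℝ)⁻¹ (inv_lt_one_of_one_lt₀ hd)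
  apply mem_hull
  apply h.full _ hx
  · intro j
    fin_cases j
    · refine ⟨a', ?_⟩
      simp [ha]
      rw [ha']; push_cast; field_simp
    · refine ⟨b', ?_⟩
      simp [hb]
      rw [hb']; push_cast; field_simp
  · intro h0
    have : m = 0 := by
      rw [smul_eq_zero] at h0
      rcases h0 with h0 | h0
      · have : (d : ℝ)⁻¹ ≠ 0 := by positivity
        exact absurd h0 this
      · exact h0
    have h2 := h.pos m hm.1
    simp [this] at h2

lemma unimod (h : Cfg S g0 g1) {p q : E2} (hp : Vis S p) (hq : Vis S q) (hD : 0 < dt p q)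
    (hF : ∀ m, Vis S m → 0 < dt p m → 0 < dt m q → False) : dt p q = 1 := by
  have hge := no_between hp hq hD hF
  obtain ⟨p0, p1, hp0, hp1, u, w, huw⟩ := hp.int h
  obtain ⟨q0, q1, hq0, hq1, -⟩ := hq.int h
  have hDz : dt p q = ((p0 * q1 - p1 * q0 : ℤ) : ℝ) := by
    simp only [dt, hp0, hp1, hq0, hq1]; push_cast; ring
  set D : ℤ := p0 * q1 - p1 * q0 with hDdef
  have hDpos : 0 < D := by rw [hDz] at hD; exact_mod_cast hD
  -- `(-w, u)` has determinant one with `p`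
  set k0 : ℤ := (-w) * q1 - u * q0 with hk0
  set n : ℤ := k0 / D with hn
  set k : ℤ := k0 % D with hk
  have hkn : k = k0 - n * D := by
    have := Int.emod_add_mul_ediv k0 D
    rw [hn, hk]; linarith
  have hk_nonneg : 0 ≤ k := Int.emod_nonneg _ hDpos.ne'
  have hk_lt : k < D := Int.emod_lt_of_pos _ hDpos
  by_contra hne
  have hD2 : 2 ≤ D := by
    have : D ≠ 1 := by
      intro h1; apply hne; rw [hDz, h1]; simp
    omega
  let x : E2 := ![((-w - n * p0 : ℤ) : ℝ), ((u - n * p1 : ℤ) : ℝ)]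
  have hx0 : x 0 = ((-w - n * p0 : ℤ) : ℝ) := rfl
  have hx1 : x 1 = ((u - n * p1 : ℤ) : ℝ) := rfl
  have e1 : dt p x = 1 := by
    simp only [dt, hp0, hp1, hx0, hx1]
    have : p0 * (u - n * p1) - p1 * (-w - n * p0) = 1 := by linarith
    exact_mod_cast this
  have e2 : dt x q = k := by
    simp only [dt, hq0, hq1, hx0, hx1]
    have : (-w - n * p0) * q1 - (u - n * p1) * q0 = k := by rw [hkn, hk0, hDdef]; ring
    exact_mod_cast this
  have hDr : (0 : ℝ) < D := by exact_mod_cast hDpos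
  have hkr : (0 : ℝ) ≤ k := by exact_mod_cast hk_nonneg
  have hkDr : (k : ℝ) + 1 ≤ D := by exact_mod_cast hk_lt
  have hxeq : x = ((k : ℝ) / D) • p + (1 / (D : ℝ)) • q := by
    have := plucker p x q
    rw [e1, e2, hDz] at this
    have h2 : x = (D : ℝ)⁻¹ • ((D : ℝ) • x) := by rw [smul_smul, inv_mul_cancel₀ hDr.ne', one_smul]
    rw [h2, ← this, smul_add, smul_smul, smul_smul, add_comm, div_eq_inv_mul, div_eq_inv_mul]
  have hxP : x ∈ convexHull ℝ (insert 0 (S : Set E2)) := by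
    rw [hxeq]
    apply tri_mem (sub_hull (mem_hull hp.1)) (sub_hull (mem_hull hq.1)) (by positivity)
      (by positivity)
    rw [← add_div, div_le_one hDr]; exact hkDr
  have hxS : x ∈ S := by
    apply h.full x hxP
    · intro j; fin_cases j
      · exact ⟨_, hx0⟩
      · exact ⟨_, hx1⟩
    · intro h0
      rw [h0] at e1
      simp [dt] at e1
  have h3 := hge x (mem_hull hxS)
  rw [e1, e2, hDz] at h3
  have hk1 : (0 : ℝ) < k := by
    have : (2 : ℝ) ≤ D := by exact_mod_cast hD2
    linarith
  refine hF x ⟨hxS, ?_⟩ (by rw [e1]; norm_num) (by rw [e2]; exact hk1)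
  intro t ht htx
  have h4 := hge _ htx
  have e3 : dt (t • x) q + dt p (t • x) = t * (dt x q + dt p x) := by simp [dt]; ring
  rw [e3, e1, e2, hDz] at h4
  nlinarith

lemma vol_std : volume {y : E2 | 0 < y 0 ∧ 0 ≤ y 1 ∧ y 0 + y 1 < 1} = ENNReal.ofReal (1 / 2) := by
  have hms : MeasurableSet {z : ℝ × ℝ | 0 < z.1 ∧ 0 ≤ z.2 ∧ z.1 + z.2 < 1} := by
    apply MeasurableSet.inter (measurableSet_lt measurable_const measurable_fst)
    apply MeasurableSet.inter (measurableSet_le measurable_const measurable_snd)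
    exact measurableSet_lt (measurable_fst.add measurable_snd) measurable_const
  have h := (volume_preserving_finTwoArrow ℝ).measure_preimage hms.nullMeasurableSet
  have h2 : (MeasurableEquiv.finTwoArrow (α := ℝ)) ⁻¹' {z : ℝ × ℝ | 0 < z.1 ∧ 0 ≤ z.2 ∧ z.1 + z.2 < 1}
      = {y : E2 | 0 < y 0 ∧ 0 ≤ y 1 ∧ y 0 + y 1 < 1} := by
    ext y; simp [MeasurableEquiv.finTwoArrow]
  rw [← h2, h, Measure.volume_eq_prod, Measure.prod_apply hms]
  have h3 : ∀ x : ℝ, volume (Prod.mk x ⁻¹' {z : ℝ × ℝ | 0 < z.1 ∧ 0 ≤ z.2 ∧ z.1 + z.2 < 1})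
      = (Set.Ioc (0 : ℝ) 1).indicator (fun x => ENNReal.ofReal (1 - x)) x := by
    intro x
    by_cases hx : x ∈ Set.Ioc (0 : ℝ) 1
    · rw [Set.indicator_of_mem hx]
      have : Prod.mk x ⁻¹' {z : ℝ × ℝ | 0 < z.1 ∧ 0 ≤ z.2 ∧ z.1 + z.2 < 1} = Set.Ico 0 (1 - x) := by
        ext y
        simp only [Set.mem_preimage, Set.mem_ofPred_eq, Set.mem_Ico]
        exact ⟨fun h => ⟨h.2.1, by linarith [h.2.2]⟩, fun h => ⟨hx.1, h.1, by linarith [h.2]⟩⟩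
      rw [this, Real.volume_Ico]; simp
    · rw [Set.indicator_of_notMem hx]
      have : Prod.mk x ⁻¹' {z : ℝ × ℝ | 0 < z.1 ∧ 0 ≤ z.2 ∧ z.1 + z.2 < 1} = ∅ := by
        ext y
        simp only [Set.mem_preimage, Set.mem_ofPred_eq, Set.mem_empty_iff_false, iff_false]
        rintro ⟨h1, h2, h3⟩
        exact hx ⟨h1, by linarith⟩
      rw [this]; simp
  simp_rw [h3]
  rw [lintegral_indicator measurableSet_Ioc, ← ofReal_integral_eq_lintegral_ofReal]
  · congr 1
    rw [← intervalIntegral.integral_of_le (by norm_num)]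
    rw [intervalIntegral.integral_sub (by simp) (by simp)]
    simp; norm_num
  · exact (Continuous.integrableOn_Icc (by fun_prop)).mono_set Set.Ioc_subset_Icc_self
  · filter_upwards [self_mem_ae_restrict measurableSet_Ioc] with x hx
    simp only [Pi.zero_apply]; linarith [hx.2]

/-- the part of `P \ P'` in the half open sector from `p` to `q` -/
def Reg (S : Finset E2) (p q : E2) : Set E2 :=
  {x | x ∈ convexHull ℝ (insert 0 (S : Set E2)) ∧ x ∉ convexHull ℝ (S : Set E2) ∧
    0 ≤ dt p x ∧ 0 < dt x q}

lemma meas_hull (S : Finset E2) : MeasurableSet (convexHull ℝ (S : Set E2)) :=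
  (S.finite_toSet.isCompact_convexHull ℝ).measurableSet

lemma meas_hull0 (S : Finset E2) : MeasurableSet (convexHull ℝ (insert 0 (S : Set E2))) :=
  ((S.finite_toSet.insert 0).isCompact_convexHull ℝ).measurableSet

lemma meas_reg (S : Finset E2) (p q : E2) : MeasurableSet (Reg S p q) := by
  apply MeasurableSet.inter (meas_hull0 S)
  apply MeasurableSet.inter (meas_hull S).compl
  apply MeasurableSet.inter
  · exact measurableSet_le (g := fun x => dt p x) measurable_const (by unfold dt; fun_prop)
  · exact measurableSet_lt (g := fun x => dt x q) measurable_const (by unfold dt; fun_prop)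

lemma vol_base (h : Cfg S g0 g1) {p q : E2} (hp : Vis S p) (hq : Vis S q) (hD : 0 < dt p q)
    (hF : ∀ m, Vis S m → 0 < dt p m → 0 < dt m q → False) :
    volume (Reg S p q) = ENNReal.ofReal (1 / 2) := by
  have hge := no_between hp hq hD hF
  have hD1 := unimod h hp hq hD hF
  rw [hD1] at hge
  let M : Matrix (Fin 2) (Fin 2) ℝ := !![p 0, q 0; p 1, q 1]
  have hM : ∀ y, Matrix.toLin' M y = y 0 • p + y 1 • q := by
    intro y; ext i; fin_cases i <;> simp [M, Matrix.toLin'_apply, Matrix.mulVec, dotProduct,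
      Fin.sum_univ_two] <;> ring
  have hdet : LinearMap.det (Matrix.toLin' M) = 1 := by
    rw [LinearMap.det_toLin', Matrix.det_fin_two, ← hD1]; simp [M, dt]; ring
  have himg : Reg S p q = Matrix.toLin' M '' {y : E2 | 0 < y 0 ∧ 0 ≤ y 1 ∧ y 0 + y 1 < 1} := by
    ext x
    constructor
    · rintro ⟨hxP, hxP', h1, h2⟩
      have hx := plucker p x q
      rw [hD1, one_smul] at hx
      refine ⟨![dt x q, dt p x], ⟨h2, h1, ?_⟩, ?_⟩
      · change dt x q + dt p x < 1
        by_contra hcon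
        push Not at hcon
        apply hxP'
        obtain ⟨l, hl0, hl1, y, hy, rfl⟩ := h.join hxP
        have hfy := hge y hy
        have hfx : dt (l • y) q + dt p (l • y) = l * (dt y q + dt p y) := by simp [dt]; ring
        rw [hfx] at hcon
        have hlpos : 0 < l := by
          rcases hl0.eq_or_lt with h0 | h0
          · rw [← h0] at hcon; norm_num at hcon
          · exact h0
        set f := dt y q + dt p y with hf
        have hfpos : 0 < f := by linarith
        have e1 : dt (l • y) q = l * dt y q := by simp [dt]; ring
        have e2 : dt p (l • y) = l * dt p y := by simp [dt]; ring
        rw [e1] at h2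
        rw [e2] at h1
        have h1' : 0 ≤ dt p y := by
          by_contra hh; push Not at hh; nlinarith
        have h2' : 0 ≤ dt y q := by
          by_contra hh; push Not at hh; nlinarith
        -- the point of the segment `[p, q]` on the ray
        have hz : f⁻¹ • y ∈ convexHull ℝ (S : Set E2) := by
          have := (convex_convexHull ℝ (S : Set E2)) (mem_hull hp.1) (mem_hull hq.1)
            (a := f⁻¹ * dt y q) (b := f⁻¹ * dt p y) (by positivity) (by positivity)
            (by rw [← mul_add, ← hf, inv_mul_cancel₀ hfpos.ne'])
          have hy' := plucker p y q
          rw [hD1, one_smul] at hy'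
          rw [mul_smul, mul_smul, ← smul_add, add_comm, hy'] at this
          exact this
        rcases hfy.eq_or_lt with hf1 | hf1
        · have : l = 1 := by rw [← hf1] at hcon; linarith
          rw [this, one_smul]; exact hy
        · have hinv : f⁻¹ < 1 := inv_lt_one_of_one_lt₀ hf1
          have hinvl : f⁻¹ ≤ l := by
            rw [inv_le_iff_one_le_mul₀ hfpos]; exact hcon
          have := (convex_convexHull ℝ (S : Set E2)) hz hy
            (a := (1 - l) / (1 - f⁻¹)) (b := (l - f⁻¹) / (1 - f⁻¹))
            (div_nonneg (by linarith) (by linarith)) (div_nonneg (by linarith) (by linarith))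
            (by rw [← add_div, div_eq_one_iff_eq (by linarith)]; ring)
          rw [smul_smul, ← add_smul] at this
          convert this using 2
          have : 1 - f⁻¹ ≠ 0 := by linarith
          rw [div_mul_eq_mul_div, ← add_div, eq_div_iff this]; ring
      · rw [hM]
        change dt x q • p + dt p x • q = x
        rw [add_comm]; exact hx
    · rintro ⟨y, ⟨h1, h2, h3⟩, rfl⟩
      rw [hM]
      have e1 : dt (y 0 • p + y 1 • q) q = y 0 * dt p q := by simp [dt]; ring
      have e2 : dt p (y 0 • p + y 1 • q) = y 1 * dt p q := by simp [dt]; ring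
      rw [hD1, mul_one] at e1 e2
      refine ⟨tri_mem (sub_hull (mem_hull hp.1)) (sub_hull (mem_hull hq.1)) h1.le h2 h3.le, ?_,
        ?_, ?_⟩
      · intro hmem
        have := hge _ hmem
        rw [e1, e2] at this
        linarith
      · rw [e2]; exact h2
      · rw [e1]; exact h1
  rw [himg, Measure.addHaar_image_linearMap, hdet, vol_std]
  simp

lemma trans_lt {p m q : E2} (hm : 0 < g0 * m 0 + g1 * m 1) 
    (h : 0 < dt p m * (g0 * q 0 + g1 * q 1) + dt m q * (g0 * p 0 + g1 * p 1)) : 0 < dt p q := by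
  have : dt p q * (g0 * m 0 + g1 * m 1) =
      dt p m * (g0 * q 0 + g1 * q 1) + dt m q * (g0 * p 0 + g1 * p 1) := by
    simp only [dt]; ring
  rw [← this] at h
  exact pos_of_mul_pos_left h hm.le

lemma trans_le {p m q : E2} (hm : 0 < g0 * m 0 + g1 * m 1) 
    (h : 0 ≤ dt p m * (g0 * q 0 + g1 * q 1) + dt m q * (g0 * p 0 + g1 * p 1)) : 0 ≤ dt p q := by
  have : dt p q * (g0 * m 0 + g1 * m 1) =
      dt p m * (g0 * q 0 + g1 * q 1) + dt m q * (g0 * p 0 + g1 * p 1) := by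
    simp only [dt]; ring
  rw [← this] at h
  exact nonneg_of_mul_nonneg_left h hm

lemma dt_swap (x y : E2) : dt x y = - dt y x := by simp only [dt]; ring

lemma Vis.eq_of_dt {m s : E2} (h : Cfg S g0 g1) (hm : Vis S m) (hs : Vis S s) (hd : dt s m = 0) :
    s = m := by
  have gm := h.pos m hm.1
  have gs := h.pos s hs.1
  have e : (g0 * m 0 + g1 * m 1) • s = (g0 * s 0 + g1 * s 1) • m := by
    simp only [dt] at hd
    ext i; fin_cases i <;> simp
    · linear_combination g1 * hd
    · linear_combination (-g0) * hd
  set A := g0 * m 0 + g1 * m 1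
  set B := g0 * s 0 + g1 * s 1
  have e1 : s = (B / A) • m := by
    rw [div_eq_inv_mul, mul_smul, ← e, smul_smul, inv_mul_cancel₀ gm.ne', one_smul]
  have e2 : m = (A / B) • s := by
    rw [div_eq_inv_mul, mul_smul, e, smul_smul, inv_mul_cancel₀ gs.ne', one_smul]
  rcases lt_trichotomy A B with hAB | hAB | hAB
  · exact absurd (e2 ▸ mem_hull hm.1) (hs.2 (A / B) (by rw [div_lt_one gs]; exact hAB))
  · rw [e1, hAB, div_self gs.ne', one_smul]
  · exact absurd (e1 ▸ mem_hull hs.1) (hm.2 (B / A) (by rw [div_lt_one gm]; exact hAB))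

open Classical in
/-- visible points strictly between `p` and `q` -/
noncomputable def Bet (S : Finset E2) (p q : E2) : Finset E2 :=
  S.filter (fun m => Vis S m ∧ 0 < dt p m ∧ 0 < dt m q)

lemma mem_bet {p q m : E2} : m ∈ Bet S p q ↔ Vis S m ∧ 0 < dt p m ∧ 0 < dt m q := by
  classical
  simp only [Bet, Finset.mem_filter]
  exact ⟨fun h => h.2, fun h => ⟨h.1.1, h⟩⟩

lemma bet_card (h : Cfg S g0 g1) {p q m : E2} (hp : Vis S p) (hq : Vis S q)
    (hm : m ∈ Bet S p q) : (Bet S p q).card = (Bet S p m).card + 1 + (Bet S m q).card := by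
  classical
  rw [mem_bet] at hm
  obtain ⟨hv, h1, h2⟩ := hm
  have gp := h.pos p hp.1
  have gq := h.pos q hq.1
  have gm := h.pos m hv.1
  have e : Bet S p q = (Bet S p m ∪ {m}) ∪ Bet S m q := by
    ext s
    simp only [Finset.mem_union, Finset.mem_singleton, mem_bet]
    constructor
    · rintro ⟨hs, h3, h4⟩
      rcases lt_trichotomy (dt s m) 0 with hlt | heq | hgt
      · right; exact ⟨hs, by rw [dt_swap]; linarith, h4⟩
      · left; right; exact hv.eq_of_dt h hs heq
      · left; left; exact ⟨hs, h3, hgt⟩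
    · rintro ((⟨hs, h3, h4⟩ | rfl) | ⟨hs, h3, h4⟩)
      · have gs := h.pos s hs.1
        exact ⟨hs, h3, trans_lt gm (by positivity)⟩
      · exact ⟨hv, h1, h2⟩
      · have gs := h.pos s hs.1
        exact ⟨hs, trans_lt gm (by positivity), h4⟩
  rw [e, Finset.card_union_of_disjoint, Finset.card_union_of_disjoint, Finset.card_singleton]
  · rw [Finset.disjoint_singleton_right, mem_bet]
    rintro ⟨-, -, h3⟩
    simp [dt, mul_comm] at h3
  · rw [Finset.disjoint_left]
    intro s hs hs'
    rw [mem_bet] at hs'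
    simp only [Finset.mem_union, Finset.mem_singleton, mem_bet] at hs
    have h3 := hs'.2.1
    rcases hs with ⟨-, -, h4⟩ | rfl
    · rw [dt_swap] at h3; linarith
    · simp [dt, mul_comm] at h3

lemma vol_reg (h : Cfg S g0 g1) (n : ℕ) : ∀ {p q : E2}, Vis S p → Vis S q → 0 < dt p q →
    (Bet S p q).card = n → 2 * volume (Reg S p q) = 1 + n := by
  induction n using Nat.strong_induction_on with
  | _ n ih =>
    intro p q hp hq hD hn
    rcases (Bet S p q).eq_empty_or_nonempty with he | ⟨m, hm⟩
    · rw [vol_base h hp hq hD]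
      · rw [← hn, he]
        have : (2 : ENNReal) = ENNReal.ofReal 2 := by simp
        rw [this, ← ENNReal.ofReal_mul (by norm_num)]
        simp
      · intro m h1 h2 h3
        have : m ∈ Bet S p q := mem_bet.2 ⟨h1, h2, h3⟩
        rw [he] at this
        simp at this
    · have hc := bet_card h hp hq hm
      rw [mem_bet] at hm
      obtain ⟨hv, h1, h2⟩ := hm
      have gp := h.pos p hp.1
      have gq := h.pos q hq.1
      have gm := h.pos m hv.1
      have e : Reg S p q = Reg S p m ∪ Reg S m q := by
        ext x
        constructor
        · rintro ⟨hx, hx', h3, h4⟩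
          rcases lt_or_ge 0 (dt x m) with h5 | h5
          · left; exact ⟨hx, hx', h3, h5⟩
          · right; exact ⟨hx, hx', by rw [dt_swap]; linarith, h4⟩
        · rintro (⟨hx, hx', h3, h4⟩ | ⟨hx, hx', h3, h4⟩)
          · have gx := h.nonneg hx
            exact ⟨hx, hx', h3, trans_lt gm (by positivity)⟩
          · have gx := h.nonneg hx
            exact ⟨hx, hx', trans_le gm (by positivity), h4⟩
      have hd : Disjoint (Reg S p m) (Reg S m q) := by
        rw [Set.disjoint_left]
        rintro x ⟨-, -, -, h3⟩ ⟨-, -, h4, -⟩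
        rw [dt_swap] at h4
        linarith
      rw [e, measure_union hd (meas_reg S m q), mul_add,
        ih (Bet S p m).card (by omega) hp hv h1 rfl, ih (Bet S m q).card (by omega) hv hq h2 rfl,
        ← hn, hc]
      push_cast
      ring

lemma exists_extreme (h : Cfg S g0 g1) (e : ℝ) (he : e ≠ 0) :
    ∃ a, Vis S a ∧ ∀ s ∈ S, 0 ≤ e * dt a s := by
  classical
  let g : E2 → ℝ := fun x => g0 * x 0 + g1 * x 1
  let k : E2 → ℝ := fun x => e * (g0 * x 1 - g1 * x 0)
  have gpos : ∀ s ∈ S, 0 < g s := h.pos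
  have hN : 0 < g0 ^ 2 + g1 ^ 2 := by
    obtain ⟨s, hs⟩ := h.ne
    have := gpos s hs
    by_contra hcon
    have h0 : g0 = 0 := by nlinarith [sq_nonneg g0, sq_nonneg g1]
    have h1 : g1 = 0 := by nlinarith [sq_nonneg g0, sq_nonneg g1]
    simp [g, h0, h1] at this
  have id1 : ∀ a s, g a * k s - g s * k a = (g0 ^ 2 + g1 ^ 2) * (e * dt a s) := by
    intro a s; simp only [g, k, dt]; ring
  obtain ⟨a1, ha1, hmin1⟩ := S.exists_min_image (fun s => k s / g s) h.ne
  obtain ⟨a, ha, hmin2⟩ := (S.filter (fun s => k s / g s = k a1 / g a1)).exists_min_image g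
    ⟨a1, by simp [ha1]⟩
  rw [Finset.mem_filter] at ha
  obtain ⟨haS, hak⟩ := ha
  have hge : ∀ s ∈ S, 0 ≤ e * dt a s := by
    intro s hs
    have h1 := hmin1 s hs
    rw [← hak, div_le_div_iff₀ (gpos a haS) (gpos s hs)] at h1
    have h2 := id1 a s
    have h3 : 0 ≤ (g0 ^ 2 + g1 ^ 2) * (e * dt a s) := by rw [← h2]; linarith
    exact nonneg_of_mul_nonneg_right h3 hN
  refine ⟨a, ⟨haS, ?_⟩, hge⟩
  intro t ht hta
  have hK : Convex ℝ {x : E2 | 0 < e * dt a x ∨ (e * dt a x = 0 ∧ g a ≤ g x)} := by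
    intro x hx y hy u v hu hv huv
    have e1 : e * dt a (u • x + v • y) = u * (e * dt a x) + v * (e * dt a y) := by
      simp [dt]; ring
    have e2 : g (u • x + v • y) = u * g x + v * g y := by simp [g]; ring
    rcases hu.eq_or_lt with hu | hu
    · have : v = 1 := by linarith
      rw [← hu, this]; simpa using hy
    rcases hv.eq_or_lt with hv | hv
    · have : u = 1 := by linarith
      rw [← hv, this]; simpa using hx
    change 0 < e * dt a (u • x + v • y) ∨ (e * dt a (u • x + v • y) = 0 ∧ g a ≤ g (u • x + v • y))
    rw [e1, e2]
    rcases hx with hx | ⟨hx, hx'⟩ <;> rcases hy with hy | ⟨hy, hy'⟩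
    · left; positivity
    · left; rw [hy]; simp; positivity
    · left; rw [hx]; simp; positivity
    · right
      refine ⟨by rw [hx, hy]; simp, ?_⟩
      have : v = 1 - u := by linarith
      subst this
      nlinarith
  have hmem := convexHull_min (s := (S : Set E2)) (fun s hs => by
    change 0 < e * dt a s ∨ (e * dt a s = 0 ∧ g a ≤ g s)
    rcases (hge s hs).eq_or_lt with h0 | h0
    · right
      refine ⟨h0.symm, hmin2 s ?_⟩
      rw [Finset.mem_filter]
      refine ⟨hs, ?_⟩
      have := id1 a s
      rw [← h0, mul_zero] at this
      rw [← hak, div_eq_div_iff (gpos s hs).ne' (gpos a haS).ne']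
      linarith
    · left; exact h0) hK hta
  have e1 : e * dt a (t • a) = 0 := by simp [dt]; right; ring
  have e2 : g (t • a) = t * g a := by simp [g]; ring
  rcases hmem with hmem | ⟨-, hmem⟩
  · rw [e1] at hmem; exact lt_irrefl _ hmem
  · rw [e2] at hmem
    have := gpos a haS
    nlinarith

lemma support {K : Set E2} (hK : Convex ℝ K) (hne : (interior K).Nonempty) {x : E2}
    (hx : x ∉ interior K) : ∃ α β : ℝ, (∀ y ∈ K, α * y 0 + β * y 1 ≤ α * x 0 + β * x 1) ∧
      ∀ y ∈ interior K, α * y 0 + β * y 1 < α * x 0 + β * x 1 := by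
  obtain ⟨f, hf⟩ := geometric_hahn_banach_open_point hK.interior isOpen_interior hx
  have hfe : ∀ y : E2, f y = f (Pi.single 0 1) * y 0 + f (Pi.single 1 1) * y 1 := by
    intro y
    have : y = y 0 • (Pi.single 0 1 : E2) + y 1 • (Pi.single 1 1 : E2) := by
      ext i; fin_cases i <;> simp
    conv_lhs => rw [this]
    rw [map_add, map_smul, map_smul]; simp; ring
  refine ⟨f (Pi.single 0 1), f (Pi.single 1 1), ?_, ?_⟩
  · intro y hy
    rw [← hfe, ← hfe]
    have h1 : y ∈ closure (interior K) := by
      rw [hK.closure_interior_eq_closure_of_nonempty_interior hne]; exact subset_closure hy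
    have h2 : closure (interior K) ⊆ {y | f y ≤ f x} :=
      closure_minimal (fun y hy => (hf y hy).le) (isClosed_le f.continuous continuous_const)
    exact h2 h1
  · intro y hy
    rw [← hfe, ← hfe]; exact hf y hy

/-- moving an interior point a little -/
lemma interior_move {K : Set E2} {x : E2} (hx : x ∈ interior K) (d : E2) :
    ∃ ε : ℝ, 0 < ε ∧ x + ε • d ∈ K := by
  have hc : Filter.Tendsto (fun ε : ℝ => x + ε • d) (nhdsWithin 0 (Set.Ioi 0)) (nhds x) := by
    have : Continuous (fun ε : ℝ => x + ε • d) := by fun_prop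
    have h := this.tendsto 0
    simp only [zero_smul, add_zero] at h
    exact h.mono_left nhdsWithin_le_nhds
  have h1 := hc.eventually (mem_interior_iff_mem_nhds.1 hx)
  obtain ⟨ε, h2, h3⟩ := (h1.and self_mem_nhdsWithin).exists
  exact ⟨ε, h3, h2⟩

lemma null_line {b : E2} (hb : b ≠ 0) : volume {x : E2 | dt x b = 0} = 0 := by
  let L : E2 →ₗ[ℝ] ℝ :=
    { toFun := fun x => dt x b
      map_add' := by intro x y; simp [dt]; ring
      map_smul' := by intro x y; simp [dt]; ring }
  have : {x : E2 | dt x b = 0} = (LinearMap.ker L : Set E2) := by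
    ext x; simp [L]
  rw [this]
  apply Measure.addHaar_submodule
  intro htop
  apply hb
  rw [LinearMap.ker_eq_top] at htop
  have h1 : L ![1, 0] = 0 := by rw [htop]; rfl
  have h2 : L ![0, 1] = 0 := by rw [htop]; rfl
  simp [L, dt] at h1 h2
  ext i; fin_cases i <;> simp [h1, h2]

theorem core (h : Cfg S g0 g1) (hPrInt : (interior (convexHull ℝ (S : Set E2))).Nonempty) :
    2 * volume (convexHull ℝ (insert 0 (S : Set E2)))
      = 2 * volume (convexHull ℝ (S : Set E2)) + 1 +
        (((interior (convexHull ℝ (insert 0 (S : Set E2))) ∩ Lat2) ∩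
          frontier (convexHull ℝ (S : Set E2))).ncard : ENNReal) := by
  obtain ⟨a, ha, haS⟩ := exists_extreme h 1 one_ne_zero
  obtain ⟨b, hb, hbS⟩ := exists_extreme h (-1) (by norm_num)
  have ga := h.pos a ha.1
  have gb := h.pos b hb.1
  have hb0 : b ≠ 0 := by
    intro h0; rw [h0] at gb; simp at gb
  have hPint : (interior (convexHull ℝ (insert 0 (S : Set E2)))).Nonempty :=
    hPrInt.mono (interior_mono sub_hull)
  have haP' : ∀ x ∈ convexHull ℝ (S : Set E2), 0 ≤ dt a x := by
    intro x hx
    have := hull_ge (S := (S : Set E2)) (-a 1) (a 0) 0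
      (fun s hs => by have := haS s hs; simp only [dt] at this; linarith) x hx
    simp only [dt]; linarith
  have hbP' : ∀ x ∈ convexHull ℝ (S : Set E2), 0 ≤ dt x b := by
    intro x hx
    have := hull_ge (S := (S : Set E2)) (b 1) (-b 0) 0
      (fun s hs => by have := hbS s hs; simp only [dt] at this; linarith) x hx
    simp only [dt]; linarith
  have haP : ∀ x ∈ convexHull ℝ (insert 0 (S : Set E2)), 0 ≤ dt a x := by
    intro x hx
    obtain ⟨l, hl, _, y, hy, rfl⟩ := h.join hx
    have := mul_nonneg hl (haP' y hy)
    have e : dt a (l • y) = l * dt a y := by simp [dt]; ring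
    rw [e]; exact this
  have hbP : ∀ x ∈ convexHull ℝ (insert 0 (S : Set E2)), 0 ≤ dt x b := by
    intro x hx
    obtain ⟨l, hl, _, y, hy, rfl⟩ := h.join hx
    have := mul_nonneg hl (hbP' y hy)
    have e : dt (l • y) b = l * dt y b := by simp [dt]; ring
    rw [e]; exact this
  -- interior points are strictly inside the sector
  have hbint : ∀ x ∈ interior (convexHull ℝ (insert 0 (S : Set E2))), 0 < dt x b := by
    intro x hx
    rcases (hbP x (interior_subset hx)).eq_or_lt with h0 | h0
    · exfalso
      obtain ⟨ε, hε, hmem⟩ := interior_move hx ![-b 1, b 0]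
      have h1 := hbP _ hmem
      have h2 : dt (x + ε • ![-b 1, b 0]) b = dt x b - ε * (b 1 ^ 2 + b 0 ^ 2) := by
        simp [dt]; ring
      rw [h2, ← h0] at h1
      have h3 : 0 < b 1 ^ 2 + b 0 ^ 2 := by
        by_contra hcon
        apply hb0
        ext i; fin_cases i <;> simp <;> nlinarith [sq_nonneg (b 0), sq_nonneg (b 1)]
      nlinarith [mul_pos hε h3]
    · exact h0
  have haint : ∀ x ∈ interior (convexHull ℝ (insert 0 (S : Set E2))), 0 < dt a x := by
    intro x hx
    rcases (haP x (interior_subset hx)).eq_or_lt with h0 | h0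
    · exfalso
      obtain ⟨ε, hε, hmem⟩ := interior_move hx ![a 1, -a 0]
      have h1 := haP _ hmem
      have h2 : dt a (x + ε • ![a 1, -a 0]) = dt a x - ε * (a 1 ^ 2 + a 0 ^ 2) := by
        simp [dt]; ring
      rw [h2, ← h0] at h1
      have h3 : 0 < a 1 ^ 2 + a 0 ^ 2 := by
        by_contra hcon
        have ha0 : a 0 = 0 := by nlinarith [sq_nonneg (a 0), sq_nonneg (a 1)]
        have ha1 : a 1 = 0 := by nlinarith [sq_nonneg (a 0), sq_nonneg (a 1)]
        rw [ha0, ha1] at ga; simp at ga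
      nlinarith [mul_pos hε h3]
    · exact h0
  have hD : 0 < dt a b := by
    obtain ⟨x, hx⟩ := hPint
    have h1 := haint x hx
    have h2 := hbint x hx
    have hx0 : 0 < g0 * x 0 + g1 * x 1 := by
      obtain ⟨l, hl, _, y, hy, rfl⟩ := h.join (interior_subset hx)
      have gy := h.pos' y hy
      rcases hl.eq_or_lt with h0 | h0
      · rw [← h0] at h1; simp [dt] at h1
      · have := mul_pos h0 gy
        simp; linarith
    exact trans_lt hx0 (by positivity)
  have hset : (interior (convexHull ℝ (insert 0 (S : Set E2))) ∩ Lat2) ∩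
          frontier (convexHull ℝ (S : Set E2)) = (Bet S a b : Set E2) := by
    have hcl : IsClosed (convexHull ℝ (S : Set E2)) :=
      (S.finite_toSet.isCompact_convexHull ℝ).isClosed
    ext x
    rw [hcl.frontier_eq, Finset.mem_coe, mem_bet]
    constructor
    · rintro ⟨⟨hxi, hxl⟩, hxP', hxn⟩
      have gx := h.pos' x hxP'
      have hx0 : x ≠ 0 := by
        intro h0; rw [h0] at gx; simp at gx
      refine ⟨⟨h.full x (interior_subset hxi) hxl hx0, ?_⟩, haint x hxi, hbint x hxi⟩
      intro t ht htx
      apply hxn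
      by_contra hni
      obtain ⟨α, β, h1, h2⟩ := support (convex_convexHull ℝ (S : Set E2)) hPrInt hni
      obtain ⟨ε, hε, hmem⟩ := interior_move hxi x
      obtain ⟨l, hl0, hl1, y, hy, hxy⟩ := h.join hmem
      have h3 := h1 _ htx
      have h4 := h1 y hy
      obtain ⟨z, hz⟩ := hPrInt
      have h5 := h2 z hz
      have c0 : x 0 + ε * x 0 = l * y 0 := by simpa using congrFun hxy 0
      have c1 : x 1 + ε * x 1 = l * y 1 := by simpa using congrFun hxy 1
      set A := α * x 0 + β * x 1 with hA
      have h3' : t * A ≤ A := by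
        simp only [Pi.smul_apply, smul_eq_mul] at h3; rw [hA] at h3 ⊢; linarith
      have hA0 : 0 ≤ A := by
        by_contra hh; push Not at hh; nlinarith
      have hA1 : (1 + ε) * A ≤ l * A := by
        have := mul_le_mul_of_nonneg_left h4 hl0
        have e : l * (α * y 0 + β * y 1) = (1 + ε) * A := by
          rw [hA]; linear_combination (-α) * c0 - β * c1
        linarith
      have hAz : A = 0 := by
        apply le_antisymm _ hA0
        by_contra hh; push Not at hh; nlinarith
      rw [hAz] at h5
      obtain ⟨δ, hδ, hmem2⟩ := interior_move hxi (-z)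
      obtain ⟨l2, hl20, _, y2, hy2, hxy2⟩ := h.join hmem2
      have h6 := h1 y2 hy2
      rw [hAz] at h6
      have c0' : x 0 + -(δ * z 0) = l2 * y2 0 := by simpa using congrFun hxy2 0
      have c1' : x 1 + -(δ * z 1) = l2 * y2 1 := by simpa using congrFun hxy2 1
      have e : l2 * (α * y2 0 + β * y2 1) = A - δ * (α * z 0 + β * z 1) := by
        rw [hA]; linear_combination (-α) * c0' - β * c1'
      have h7 := mul_nonpos_of_nonneg_of_nonpos hl20 h6
      have h8 := mul_neg_of_pos_of_neg hδ h5
      rw [e, hAz] at h7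
      linarith
    · rintro ⟨hv, h1, h2⟩
      refine ⟨⟨?_, h.lat x hv.1⟩, mem_hull hv.1, ?_⟩
      · by_contra hni
        obtain ⟨α, β, h3, h4⟩ := support (convex_convexHull ℝ (insert 0 (S : Set E2))) hPint hni
        obtain ⟨z, hz⟩ := hPrInt
        have hzP' := interior_subset hz
        have hz4 := h4 z (interior_mono sub_hull hz)
        have h30 := h3 0 zero_mem_hull
        have h3a := h3 a (sub_hull (mem_hull ha.1))
        have h3b := h3 b (sub_hull (mem_hull hb.1))
        simp only [Pi.zero_apply, mul_zero, add_zero] at h30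
        -- the linear identity applied to the supporting functional
        have pl : ∀ u m w : E2, dt u m * (α * w 0 + β * w 1) + dt m w * (α * u 0 + β * u 1)
            = dt u w * (α * m 0 + β * m 1) := by
          intro u m w; simp only [dt]; ring
        have hza := haP' z hzP'
        have hzb := hbP' z hzP'
        generalize hgen : (fun u : E2 => α * u 0 + β * u 1) = ℓ at *
        have hl : ∀ u : E2, α * u 0 + β * u 1 = ℓ u := fun u => by rw [← hgen]
        simp only [hl] at *
        rcases le_total 0 (dt x z) with hs | hs
        · have hc := hv.chain (mem_hull ha.1) hzP' h1.le hs (by linarith)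
          have p1 := pl a x z
          have q1 := mul_lt_mul_of_pos_left hz4 h1
          have q2 := mul_le_mul_of_nonneg_left h3a hs
          have q3 := mul_le_mul_of_nonneg_right hc h30
          linarith
        · have hs' : 0 ≤ dt z x := by rw [dt_swap]; linarith
          have hc := hv.chain hzP' (mem_hull hb.1) hs' h2.le (by linarith)
          have p1 := pl z x b
          have q1 := mul_lt_mul_of_pos_left hz4 h2
          have q2 := mul_le_mul_of_nonneg_left h3b hs'
          have q3 := mul_le_mul_of_nonneg_right hc h30
          linarith
      · intro hxi
        obtain ⟨ε, hε, hmem⟩ := interior_move hxi (-x)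
        apply hv.2 (1 - ε) (by linarith)
        convert hmem using 1
        rw [sub_smul, one_smul, smul_neg, sub_eq_add_neg]
  have hvol := vol_reg h _ ha hb hD rfl
  rw [hset, Set.ncard_coe_finset]
  have hdiff : volume (convexHull ℝ (insert 0 (S : Set E2)) \ convexHull ℝ (S : Set E2))
      = volume (Reg S a b) := by
    apply le_antisymm
    · calc _ ≤ volume (Reg S a b ∪ {x : E2 | dt x b = 0}) := by
            apply measure_mono
            rintro x ⟨hx, hx'⟩
            rcases (hbP x hx).eq_or_lt with h0 | h0
            · right; exact h0.symm
            · left; exact ⟨hx, hx', haP x hx, h0⟩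
        _ ≤ volume (Reg S a b) + volume {x : E2 | dt x b = 0} := measure_union_le _ _
        _ = _ := by rw [null_line hb0, add_zero]
    · apply measure_mono
      rintro x ⟨hx, hx', -, -⟩
      exact ⟨hx, hx'⟩
  rw [← measure_sdiff_add_inter (convexHull ℝ (insert 0 (S : Set E2))) (meas_hull S),
    Set.inter_eq_self_of_subset_right sub_hull, hdiff, mul_add, hvol]
  ring

lemma finite_lat {P : Set E2} (hP : Bornology.IsBounded P) : (P ∩ Lat2).Finite := by
  obtain ⟨r, hr⟩ := hP.subset_closedBall 0
  obtain ⟨N, hN⟩ := exists_nat_gt r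
  apply ((Set.finite_Icc (fun _ => -(N : ℤ) : Fin 2 → ℤ) (fun _ => (N : ℤ))).image
    (fun z i => (z i : ℝ))).subset
  rintro x ⟨hx, hl⟩
  choose m hm using hl
  have hx' := hr hx
  rw [mem_closedBall_zero_iff] at hx'
  have hb : ∀ i, |x i| ≤ N := fun i => by
    have := norm_le_pi_norm x i
    rw [Real.norm_eq_abs] at this
    linarith
  refine ⟨m, ⟨fun i => ?_, fun i => ?_⟩, ?_⟩
  · have := (abs_le.1 (hb i)).1
    rw [hm] at this
    exact_mod_cast this
  · have := (abs_le.1 (hb i)).2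
    rw [hm] at this
    exact_mod_cast this
  · ext i; exact (hm i).symm

/-- the theorem when the vertex is the origin -/
theorem origin (P : Set E2) (V : Finset E2)
    (hV : (V : Set E2) ⊆ Lat2) (hP : P = convexHull ℝ (V : Set E2))
    (hv : (0 : E2) ∈ Set.extremePoints ℝ P)
    (hdim' : (interior (convexHull ℝ ((P ∩ Lat2) \ {0}))).Nonempty) :
    2 * volume P = 2 * volume (convexHull ℝ ((P ∩ Lat2) \ {0})) + 1
          + (((interior P ∩ Lat2) ∩
              frontier (convexHull ℝ ((P ∩ Lat2) \ {0}))).ncard : ENNReal) := by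
  have hPc : Convex ℝ P := hP ▸ convex_convexHull ℝ _
  have hPb : Bornology.IsBounded P := by
    rw [hP]; exact (V.finite_toSet.isCompact_convexHull ℝ).isBounded
  have hfin : ((P ∩ Lat2) \ {0}).Finite := (finite_lat hPb).subset Set.sdiff_subset
  set S := hfin.toFinset with hS
  have hSc : (S : Set E2) = (P ∩ Lat2) \ {0} := hfin.coe_toFinset
  rw [← hSc] at hdim' ⊢
  have hPS : P = convexHull ℝ (insert 0 (S : Set E2)) := by
    apply subset_antisymm
    · rw [hP]
      apply convexHull_mono
      intro x hx
      by_cases h0 : x = 0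
      · left; exact h0
      · right
        rw [hSc]
        exact ⟨⟨hP ▸ subset_convexHull ℝ _ hx, hV hx⟩, h0⟩
    · apply convexHull_min _ hPc
      rintro x (rfl | hx)
      · exact hv.1
      · rw [hSc] at hx; exact hx.1.1
  have h0 : (0 : E2) ∉ convexHull ℝ (S : Set E2) := by
    have hc := (hPc.mem_extremePoints_iff_convex_sdiff.1 hv).2
    intro hmem
    have := convexHull_min (s := (S : Set E2)) (t := P \ {0}) (by
      rw [hSc]; rintro x ⟨⟨h1, -⟩, h2⟩; exact ⟨h1, h2⟩) hc hmem
    exact this.2 rfl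
  obtain ⟨f, u, hf1, hf2⟩ := geometric_hahn_banach_point_closed (convex_convexHull ℝ (S : Set E2))
    (S.finite_toSet.isCompact_convexHull ℝ).isClosed h0
  rw [map_zero] at hf1
  have hfe : ∀ y : E2, f y = f (Pi.single 0 1) * y 0 + f (Pi.single 1 1) * y 1 := by
    intro y
    have : y = y 0 • (Pi.single 0 1 : E2) + y 1 • (Pi.single 1 1 : E2) := by
      ext i; fin_cases i <;> simp
    conv_lhs => rw [this]
    rw [map_add, map_smul, map_smul]; simp; ring
  have hcfg : Cfg S (f (Pi.single 0 1)) (f (Pi.single 1 1)) := by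
    refine ⟨?_, ?_, ?_, ?_⟩
    · intro s hs
      have : s ∈ (S : Set E2) := hs
      rw [hSc] at this; exact this.1.2
    · intro x hx hl hx0
      rw [← hPS] at hx
      have : x ∈ (S : Set E2) := by rw [hSc]; exact ⟨⟨hx, hl⟩, hx0⟩
      exact this
    · intro s hs
      rw [← hfe]
      exact hf1.trans (hf2 s (mem_hull hs))
    · have := hdim'.mono interior_subset
      rw [convexHull_nonempty_iff] at this
      exact_mod_cast this
  rw [hPS]
  exact core hcfg hdim'

end VEO

theorem vertex_euler_obstruction_surface (P : Set (Fin 2 → ℝ)) (V : Finset (Fin 2 → ℝ))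
    (hV : (V : Set (Fin 2 → ℝ)) ⊆ Lat2) (hP : P = convexHull ℝ (V : Set (Fin 2 → ℝ)))
    (hdim : (interior P).Nonempty)
    (v : Fin 2 → ℝ) (hv : v ∈ Set.extremePoints ℝ P)
    (hdim' : (interior (convexHull ℝ ((P ∩ Lat2) \ {v}))).Nonempty) :
    2 * (volume P).toReal
        = 2 * (volume (convexHull ℝ ((P ∩ Lat2) \ {v}))).toReal + 1
          + (((interior P ∩ Lat2) ∩
              frontier (convexHull ℝ ((P ∩ Lat2) \ {v}))).ncard : ℝ) ∧
      2 - 2 * (volume P).toReal + 2 * (volume (convexHull ℝ ((P ∩ Lat2) \ {v}))).toReal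
        = 1 - (((interior P ∩ Lat2) ∩
              frontier (convexHull ℝ ((P ∩ Lat2) \ {v}))).ncard : ℝ) := by
  classical
  have hvV : v ∈ V := by
    rw [hP] at hv
    exact_mod_cast extremePoints_convexHull_subset hv
  have hvL : v ∈ Lat2 := hV hvV
  let τ : (Fin 2 → ℝ) ≃ₜ (Fin 2 → ℝ) := Homeomorph.addLeft (-v)
  have hτ : ∀ x, τ x = -v + x := fun x => rfl
  have hτL : τ '' Lat2 = Lat2 := by
    ext x
    constructor
    · rintro ⟨y, hy, rfl⟩ j
      obtain ⟨m, hm⟩ := hy j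
      obtain ⟨n, hn⟩ := hvL j
      exact ⟨-n + m, by rw [hτ]; simp [hm, hn]⟩
    · intro hx
      refine ⟨v + x, fun j => ?_, by rw [hτ]; simp⟩
      obtain ⟨m, hm⟩ := hx j
      obtain ⟨n, hn⟩ := hvL j
      exact ⟨n + m, by simp [hm, hn]⟩
  have hτv : τ '' {v} = {0} := by rw [Set.image_singleton, hτ]; simp
  have hτc : ∀ A : Set (Fin 2 → ℝ), τ '' (convexHull ℝ A) = convexHull ℝ (τ '' A) := by
    intro A
    have := convexHull_vadd (𝕜 := ℝ) (-v) A
    exact this.symm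
  have hτm : ∀ A : Set (Fin 2 → ℝ), volume (τ '' A) = volume A := by
    intro A
    have := measure_vadd (μ := (volume : Measure (Fin 2 → ℝ))) (-v) A
    exact this
  have hQ : τ '' ((P ∩ Lat2) \ {v}) = (τ '' P ∩ Lat2) \ {0} := by
    rw [Set.image_sdiff τ.injective, Set.image_inter τ.injective, hτL, hτv]
  have key := VEO.origin (τ '' P) (V.image τ)
    (by
      rw [Finset.coe_image]
      exact (Set.image_mono hV).trans hτL.subset)
    (by rw [Finset.coe_image, ← hτc, hP])
    (by
      rw [mem_extremePoints]
      refine ⟨⟨v, hv.1, by rw [hτ]; simp⟩, ?_⟩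
      rintro _ ⟨x, hx, rfl⟩ _ ⟨y, hy, rfl⟩ ⟨a, b, ha, hb, hab, h0⟩
      have hh := (mem_extremePoints.1 hv).2 x hx y hy ⟨a, b, ha, hb, hab, by
        rw [hτ, hτ] at h0
        have : a • x + b • y = (a + b) • v + (a • (-v + x) + b • (-v + y)) := by module
        rw [this, h0, hab]; simp⟩
      rw [hh.1, hh.2, hτ]
      simp)
    (by
      rw [← hQ, ← hτc, ← τ.image_interior]
      exact hdim'.image _)
  rw [← hQ, ← hτc, hτm, hτm, ← τ.image_interior, ← τ.image_frontier] at key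
  nth_rewrite 2 [← hτL] at key
  rw [← Set.image_inter τ.injective, ← Set.image_inter τ.injective,
    Set.ncard_image_of_injective _ τ.injective] at key
  have hPb : volume P ≠ ⊤ := by
    rw [hP]; exact (V.finite_toSet.isCompact_convexHull ℝ).measure_lt_top.ne
  have hP'b : volume (convexHull ℝ ((P ∩ Lat2) \ {v})) ≠ ⊤ := by
    apply ne_top_of_le_ne_top hPb
    apply measure_mono
    apply convexHull_min
    · intro x hx; exact hx.1.1
    · rw [hP]; exact convex_convexHull ℝ _
  have key2 := congrArg ENNReal.toReal key
  rw [ENNReal.toReal_add (by finiteness) (by simp), ENNReal.toReal_add (by finiteness) (by simp),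
    ENNReal.toReal_mul, ENNReal.toReal_mul, ENNReal.toReal_natCast] at key2
  simp only [ENNReal.toReal_ofNat, ENNReal.toReal_one] at key2
  constructor <;> linarith
end

section
/- Let d > k ≥ 1 be coprime integers, and let d/k = [b₁,…,b_s]⁻ and d/(d−k) = [c₁,…,c_r]⁻ be the Hirzebruch–Jung continued fraction expansions. Then r = 1 + Σ_{i=1}^{s} (b_i − 2). -/
/-- Hirzebruch–Jung continued fraction expansion of `d/k`:
`[d]⁻` for `k ≤ 1`, and otherwise first entry `⌈d/k⌉` followed by the expansion of
`k/(⌈d/k⌉·k − d)`. -/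
def hjList (d k : ℕ) : List ℕ :=
  if h : k ≤ 1 then [d]
  else
    (d + k - 1) / k :: hjList k ((d + k - 1) / k * k - d)
termination_by k
decreasing_by
  have h1 : (d + k - 1) / k * k ≤ d + k - 1 := Nat.div_mul_le_self _ _
  omega

theorem hjList_shift (m k : ℕ) (hk : 1 ≤ k) :
    ∃ a t, hjList m k = a :: t ∧ hjList (m + k) k = (a + 1) :: t := by
  rcases Nat.lt_or_ge 1 k with h | h
  · have e : (m + k + k - 1) / k = (m + k - 1) / k + 1 := by
      rw [show m + k + k - 1 = (m + k - 1) + k by omega, Nat.add_div_right _ (by omega)]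
    refine ⟨_, _, by rw [hjList, dif_neg (by omega)], ?_⟩
    rw [hjList, dif_neg (by omega), e]
    congr 2
    rw [Nat.add_mul, one_mul]
    omega
  · obtain rfl : k = 1 := by omega
    exact ⟨m, [], by rw [hjList, dif_pos le_rfl], by rw [hjList, dif_pos le_rfl]⟩

theorem hjList_two (n m : ℕ) (hm : 1 ≤ m) (h : m < n) :
    hjList (n + m) n = 2 :: hjList n (n - m) := by
  have e : (n + m + n - 1) / n = 2 := by
    rw [Nat.div_eq_iff (by omega)]
    omega
  rw [hjList, dif_neg (by omega), e]
  congr 2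
  omega

theorem hj_aux (N : ℕ) : ∀ k m : ℕ, k + m ≤ N → 1 ≤ k → 1 ≤ m → Nat.Coprime k m →
    ((hjList (k + m) m).length : ℤ)
      = 1 + ((hjList (k + m) k).map (fun b => (b : ℤ) - 2)).sum := by
  induction N with
  | zero => intro k m h h1; omega
  | succ N ih =>
    intro k m h hk hm hco
    rcases lt_trichotomy k m with hlt | heq | hlt
    · have h1 := hjList_two m k hk hlt
      obtain ⟨a, t, h2, h3⟩ := hjList_shift m k hk
      have := ih k (m - k) (by omega) hk (by omega)
        ((Nat.coprime_sub_self_right hlt.le).2 hco)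
      rw [show k + (m - k) = m by omega, h2] at this
      rw [Nat.add_comm k m, h1, h3]
      simp only [List.bind_eq_flatMap, List.pure_def, List.flatMap_cons, List.singleton_append,
        List.length_cons, List.map_cons, List.sum_cons] at this ⊢
      push_cast at this ⊢
      linarith
    · subst heq
      obtain rfl : k = 1 := by simpa using hco
      have : hjList (1 + 1) 1 = [2] := by rw [hjList, dif_pos le_rfl]
      rw [this]; simp
    · have h1 := hjList_two k m hm hlt
      obtain ⟨a, t, h2, h3⟩ := hjList_shift k m hm
      have := ih (k - m) m (by omega) (by omega) hm
        ((Nat.coprime_sub_self_left hlt.le).2 hco)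
      rw [show k - m + m = k by omega, h2] at this
      rw [h1, h3]
      simp only [List.bind_eq_flatMap, List.pure_def, List.flatMap_cons, List.singleton_append,
        List.length_cons, List.map_cons, List.sum_cons] at this ⊢
      push_cast at this ⊢
      linarith

/-- if `d/k = [b₁,…,b_s]⁻` and `d/(d−k) = [c₁,…,c_r]⁻`, then
`r = 1 + Σᵢ (bᵢ − 2)`. -/
theorem hj_length_of_complement (d k : ℕ) (hk : 1 ≤ k) (hd : k < d)
    (hco : Nat.Coprime d k) :
    ((hjList d (d - k)).length : ℤ)
      = 1 + ((hjList d k).map (fun b => (b : ℤ) - 2)).sum := by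
  have := hj_aux d k (d - k) (by omega) hk (by omega)
    ((Nat.coprime_sub_self_right hd.le).2 hco.symm)
  rwa [show k + (d - k) = d by omega] at this
end

section
/- For every integer k ≥ 1, δ(2k−1, 2k, 2k+1) = 24k³ − 20k + 3; that is, the dual variety of the weighted projective plane ℙ(2k−1, 2k, 2k+1) has degree 24k³ − 20k + 3. -/
/-- `Σᵢ (2 − bᵢ)` where `d/k = [b₁,…,b_r]⁻` is the Hirzebruch–Jung expansion. -/
def hjEu (d k : ℕ) : ℤ := ((hjList d k).map (fun b => 2 - (b : ℤ))).sum

theorem hjEu_le_one (d k : ℕ) (h : k ≤ 1) : hjEu d k = 2 - (d : ℤ) := by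
  unfold hjEu
  rw [hjList]
  simp [h]

theorem hjEu_step (d k q r : ℕ) (h : ¬ k ≤ 1) (hr : r < k) (hq : q * k = d + r) :
    hjEu d k = 2 - (q : ℤ) + hjEu k r := by
  have e : (d + k - 1) / k = q := by
    rw [Nat.div_eq_iff (by omega)]
    constructor <;> omega
  have e2 : q * k - d = r := by omega
  unfold hjEu
  rw [hjList]
  simp [h, e, e2]

theorem hjEu_twos (n : ℕ) : hjEu (n + 2) (n + 1) = 0 := by
  induction n with
  | zero => rw [hjEu_le_one _ _ (by omega)]; simp
  | succ n ih =>
    rw [hjEu_step (n + 1 + 2) (n + 1 + 1) 2 (n + 1) (by omega) (by omega) (by omega), ih]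
    simp

/-- the dual variety of `ℙ(2k−1, 2k, 2k+1)` has degree `24k³ − 20k + 3`;
stated via the Matsui–Takeuchi degree formula
`δ(K,M,N) = 3KMN − 2(K+M+N) + Σ(2−aᵢ) + Σ(2−bᵢ) + Σ(2−cᵢ)` with `a, b, c` the minimal
nonnegative solutions of the three congruences and the HJ-expansions
`K/(K−a) = [a₁,…]⁻`, `M/(M−b) = [b₁,…]⁻`, `N/(N−c) = [c₁,…]⁻`. -/
theorem deg_dual_wpp_consecutive (k : ℕ) (hk : 1 ≤ k) (a b c : ℕ)
    (ha : (2 * k - 1) ∣ (2 * k + a * (2 * k + 1)))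
    (hamin : ∀ a' < a, ¬ (2 * k - 1) ∣ (2 * k + a' * (2 * k + 1)))
    (hb : (2 * k) ∣ ((2 * k + 1) + b * (2 * k - 1)))
    (hbmin : ∀ b' < b, ¬ (2 * k) ∣ ((2 * k + 1) + b' * (2 * k - 1)))
    (hc : (2 * k + 1) ∣ ((2 * k - 1) + c * (2 * k)))
    (hcmin : ∀ c' < c, ¬ (2 * k + 1) ∣ ((2 * k - 1) + c' * (2 * k))) :
    3 * ((2 * k - 1 : ℕ) : ℤ) * (2 * k) * (2 * k + 1)
        - 2 * (((2 * k - 1 : ℕ) : ℤ) + (2 * k) + (2 * k + 1))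
        + hjEu (2 * k - 1) ((2 * k - 1) - a)
        + hjEu (2 * k) ((2 * k) - b)
        + hjEu (2 * k + 1) ((2 * k + 1) - c)
      = 24 * (k : ℤ) ^ 3 - 20 * (k : ℤ) + 3 := by
  have ea : a = k - 1 := by
    apply le_antisymm
    · by_contra hlt
      apply hamin (k - 1) (by omega)
      refine ⟨k + 1, ?_⟩
      obtain ⟨j, rfl⟩ := Nat.exists_eq_add_of_le' hk
      have : 2 * (j + 1) - 1 = 2 * j + 1 := by omega
      rw [this, Nat.add_sub_cancel]
      ring
    · by_contra hlt
      have h1 : (2 * k - 1) ∣ 1 + 2 * a := by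
        have h2 : 2 * k + a * (2 * k + 1) = (2 * k - 1) * (1 + a) + (1 + 2 * a) := by
          obtain ⟨j, rfl⟩ := Nat.exists_eq_add_of_le' hk
          have : 2 * (j + 1) - 1 = 2 * j + 1 := by omega
          rw [this]
          ring
        rw [h2] at ha
        exact (Nat.dvd_add_right (Dvd.intro _ rfl)).1 ha
      have := Nat.le_of_dvd (by omega) h1
      omega
  have eb : b = 1 := by
    apply le_antisymm
    · by_contra hlt
      exact hbmin 1 (by omega) ⟨2, by omega⟩
    · by_contra hlt
      have h0 : b = 0 := by omega
      subst h0
      have h1 : (2 * k) ∣ 1 := by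
        rw [Nat.zero_mul, Nat.add_zero] at hb
        exact (Nat.dvd_add_right (dvd_refl _)).1 hb
      have := Nat.le_of_dvd (by omega) h1
      omega
  have ec : c = 2 * k - 1 := by
    apply le_antisymm
    · by_contra hlt
      apply hcmin (2 * k - 1) (by omega)
      exact ⟨2 * k - 1, by ring⟩
    · by_contra hlt
      have h1 : (2 * k + 1) ∣ c + 2 := by
        refine (Nat.dvd_add_right hc).1 ⟨1 + c, ?_⟩
        have : 2 * k - 1 + c * (2 * k) + (c + 2) = (2 * k - 1 + 2) + c * (2 * k) + c := by ring
        rw [this, show 2 * k - 1 + 2 = 2 * k + 1 by omega]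
        ring
      have := Nat.le_of_dvd (by omega) h1
      omega
  subst ea eb ec
  have h1 : hjEu (2 * k - 1) ((2 * k - 1) - (k - 1)) = 2 - (k : ℤ) := by
    rw [show (2 * k - 1) - (k - 1) = k by omega]
    by_cases h : k ≤ 1
    · rw [hjEu_le_one _ _ h]
      have : k = 1 := by omega
      subst this
      simp
    · rw [hjEu_step _ _ 2 1 h (by omega) (by omega), hjEu_le_one _ _ le_rfl]
      simp
  have h2 : hjEu (2 * k) (2 * k - 1) = 0 := by
    have := hjEu_twos (2 * k - 2)
    rwa [show 2 * k - 2 + 2 = 2 * k by omega, show 2 * k - 2 + 1 = 2 * k - 1 by omega] at this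
  have h3 : hjEu (2 * k + 1) ((2 * k + 1) - (2 * k - 1)) = 1 - (k : ℤ) := by
    rw [show (2 * k + 1) - (2 * k - 1) = 2 by omega,
      hjEu_step _ _ (k + 1) 1 (by omega) (by omega) (by omega), hjEu_le_one _ _ le_rfl]
    push_cast
    ring
  rw [h1, h2, h3]
  have : ((2 * k - 1 : ℕ) : ℤ) = 2 * k - 1 := by omega
  rw [this]
  ring
end

section
/- For all coprime positive integers m, n, δ(m, n, m+n) = 3mn(m+n) − 5(m+n) + 4; that is, the dual variety of the weighted projective plane ℙ(m, n, m+n) has degree 3mn(m+n) − 5(m+n) + 4. -/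
theorem hjEu_one (d : ℕ) : hjEu d 1 = 2 - (d : ℤ) := by
  unfold hjEu
  rw [hjList]
  simp

theorem hjEu_succ (k : ℕ) : hjEu (k + 2) (k + 1) = 0 := by
  induction k with
  | zero => rw [hjEu_one]; norm_num
  | succ k ih =>
    unfold hjEu at ih ⊢
    rw [hjList]
    have h1 : (k + 1 + 2 + (k + 1 + 1) - 1) / (k + 1 + 1) = 2 := by
      have : k + 1 + 2 + (k + 1 + 1) - 1 = 2 * (k + 1 + 1) := by omega
      rw [this]
      exact Nat.mul_div_cancel _ (by omega)
    have h2 : 2 * (k + 1 + 1) - (k + 1 + 2) = k + 1 := by omega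
    rw [dif_neg (by omega), h1, h2]
    simpa using ih

theorem min_sol (m n a : ℕ) (hm : 0 < m) (hco : Nat.Coprime m n)
    (h : m ∣ n * (a + 1)) (hmin : ∀ a' < a, ¬ m ∣ n * (a' + 1)) : m - a = 1 := by
  have h1 : m ≤ a + 1 := Nat.le_of_dvd (by omega) (hco.dvd_of_dvd_mul_left h)
  by_contra hne
  refine hmin (m - 1) (by omega) ?_
  rw [Nat.sub_add_cancel hm]
  exact dvd_mul_left _ _

/-- the dual variety of `ℙ(m, n, m+n)` has degree `3mn(m+n) − 5(m+n) + 4`;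
stated via the Matsui–Takeuchi degree formula with the weights `(K,M,N) = (m, n, m+n)`,
`a, b, c` the minimal nonnegative solutions of the congruences, and HJ-expansions. -/
theorem deg_dual_wpp_fibonacci (m n : ℕ) (hm : 0 < m) (hn : 0 < n)
    (hco : Nat.Coprime m n) (a b c : ℕ)
    (ha : m ∣ (n + a * (m + n)))
    (hamin : ∀ a' < a, ¬ m ∣ (n + a' * (m + n)))
    (hb : n ∣ ((m + n) + b * m))
    (hbmin : ∀ b' < b, ¬ n ∣ ((m + n) + b' * m))
    (hc : (m + n) ∣ (m + c * n))
    (hcmin : ∀ c' < c, ¬ (m + n) ∣ (m + c' * n)) :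
    3 * (m : ℤ) * (n : ℤ) * ((m : ℤ) + n)
        - 2 * ((m : ℤ) + n + ((m : ℤ) + n))
        + hjEu m (m - a) + hjEu n (n - b) + hjEu (m + n) ((m + n) - c)
      = 3 * (m : ℤ) * (n : ℤ) * ((m : ℤ) + n) - 5 * ((m : ℤ) + n) + 4 := by
  have key1 : ∀ x, m ∣ (n + x * (m + n)) ↔ m ∣ n * (x + 1) := by
    intro x
    rw [show n + x * (m + n) = m * x + n * (x + 1) by ring]
    exact Nat.dvd_add_right (dvd_mul_right _ _)
  have key2 : ∀ x, n ∣ ((m + n) + x * m) ↔ n ∣ m * (x + 1) := by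
    intro x
    rw [show (m + n) + x * m = n + m * (x + 1) by ring]
    exact Nat.dvd_add_right (dvd_refl _)
  have e1 : m - a = 1 := min_sol m n a hm hco ((key1 a).1 ha)
    (fun x hx h => hamin x hx ((key1 x).2 h))
  have e2 : n - b = 1 := min_sol n m b hn hco.symm ((key2 b).1 hb)
    (fun x hx h => hbmin x hx ((key2 x).2 h))
  have c1 : c = 1 := by
    have hle : ¬ 1 < c := fun h => hcmin 1 h (by simp)
    have h0 : c ≠ 0 := by
      rintro rfl
      have := Nat.le_of_dvd (by omega) hc
      omega
    omega
  obtain ⟨k, hk⟩ : ∃ k, m + n = k + 2 := ⟨m + n - 2, by omega⟩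
  have e3 : hjEu (m + n) ((m + n) - c) = 0 := by
    rw [c1, hk]
    exact hjEu_succ k
  rw [e1, e2, e3, hjEu_one, hjEu_one]
  ring
end

section
/- Let m be an odd positive integer and n a positive integer with gcd(m,n) = 1. Then δ(m, n, m+2n) = 6mn² + 3m²n − 7n − (9/2)m + 5/2 (equivalently, 2·δ(m, n, m+2n) = 12mn² + 6m²n − 14n − 9m + 5); that is, the dual variety of ℙ(m, n, m+2n) has this degree. -/
theorem hjEu_step_s13 (d k : ℕ) (hk : 2 ≤ k) (h1 : k < d) (h2 : d ≤ 2 * k) :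
    hjEu d k = hjEu k (2 * k - d) := by
  have hq : (d + k - 1) / k = 2 := by
    apply Nat.div_eq_of_lt_le <;> omega
  unfold hjEu
  rw [hjList, dif_neg (by omega), hq]
  simp

theorem hjEu_sub_two (j : ℕ) : hjEu (2 * j + 3) (2 * j + 1) = -1 := by
  induction j with
  | zero => simp [hjEu_one]
  | succ j ih =>
    rw [hjEu_step_s13 _ _ (by omega) (by omega) (by omega)]
    have e : 2 * (2 * (j + 1) + 1) - (2 * (j + 1) + 3) = 2 * j + 1 := by omega
    rw [e]
    exact ih

theorem hjEu_half (t : ℕ) : hjEu (2 * t + 1) (t + 1) = 1 - (t : ℤ) := by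
  rcases Nat.eq_zero_or_pos t with rfl | ht
  · simp [hjEu_one]
  · rw [hjEu_step_s13 _ _ (by omega) (by omega) (by omega)]
    have e : 2 * (t + 1) - (2 * t + 1) = 1 := by omega
    rw [e, hjEu_one]
    push_cast
    ring

/-- for `m` odd, `gcd(m,n) = 1`, the dual variety of `ℙ(m, n, m+2n)` has
degree `6mn² + 3m²n − 7n − (9/2)m + 5/2`; stated (both in ℚ and in the equivalent
doubled integer form) via the Matsui–Takeuchi degree formula with weights
`(K,M,N) = (m, n, m+2n)`. -/
theorem deg_dual_wpp_m_n_m_add_two_n (m n : ℕ) (hodd : Odd m) (hm : 0 < m) (hn : 0 < n)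
    (hco : Nat.Coprime m n) (a b c : ℕ)
    (ha : m ∣ (n + a * (m + 2 * n)))
    (hamin : ∀ a' < a, ¬ m ∣ (n + a' * (m + 2 * n)))
    (hb : n ∣ ((m + 2 * n) + b * m))
    (hbmin : ∀ b' < b, ¬ n ∣ ((m + 2 * n) + b' * m))
    (hc : (m + 2 * n) ∣ (m + c * n))
    (hcmin : ∀ c' < c, ¬ (m + 2 * n) ∣ (m + c' * n)) :
    ((3 * (m : ℤ) * (n : ℤ) * ((m : ℤ) + 2 * n)
          - 2 * ((m : ℤ) + n + ((m : ℤ) + 2 * n))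
          + hjEu m (m - a) + hjEu n (n - b)
          + hjEu (m + 2 * n) ((m + 2 * n) - c) : ℤ) : ℚ)
        = 6 * (m : ℚ) * (n : ℚ) ^ 2 + 3 * (m : ℚ) ^ 2 * n - 7 * n
            - (9 / 2 : ℚ) * m + 5 / 2 ∧
      2 * (3 * (m : ℤ) * (n : ℤ) * ((m : ℤ) + 2 * n)
          - 2 * ((m : ℤ) + n + ((m : ℤ) + 2 * n))
          + hjEu m (m - a) + hjEu n (n - b)
          + hjEu (m + 2 * n) ((m + 2 * n) - c))
        = 12 * (m : ℤ) * (n : ℤ) ^ 2 + 6 * (m : ℤ) ^ 2 * n - 14 * n - 9 * m + 5 := by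
  have hA : 2 * a + 1 = m := by
    obtain ⟨t, rfl⟩ := hodd
    have h1 : (2 * t + 1) ∣ (2 * a + 1) := by
      have h : (2 * t + 1) ∣ n * (2 * a + 1) := by
        have : n + a * (2 * t + 1 + 2 * n) = (2 * t + 1) * a + n * (2 * a + 1) := by ring
        rw [this] at ha
        exact (Nat.dvd_add_right (dvd_mul_right _ _)).1 ha
      exact hco.dvd_of_dvd_mul_left h
    have h2 := Nat.le_of_dvd (by omega) h1
    have h3 : ¬ t < a := fun h => hamin t h ⟨n + t, by ring⟩
    omega
  have hB : b + 1 = n := by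
    have h1 : n ∣ b + 1 := by
      have h : n ∣ m * (b + 1) := by
        have : m + 2 * n + b * m = n * 2 + m * (b + 1) := by ring
        rw [this] at hb
        exact (Nat.dvd_add_right (dvd_mul_right _ _)).1 hb
      exact hco.symm.dvd_of_dvd_mul_left h
    have h2 := Nat.le_of_dvd (by omega) h1
    have h3 : ¬ n - 1 < b := fun h => hbmin (n - 1) h ⟨m + 2, by
      obtain ⟨s, rfl⟩ : ∃ s, n = s + 1 := ⟨n - 1, by omega⟩
      simp only [Nat.add_sub_cancel]
      ring⟩
    omega
  have hC : c = 2 := by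
    have h3 : ¬ 2 < c := fun h => hcmin 2 h (dvd_refl _)
    have h4 : c ≤ 2 := by omega
    interval_cases c
    · have := Nat.le_of_dvd (by omega) hc
      omega
    · have := Nat.le_of_dvd (by omega) hc
      omega
    · rfl
  have e1 : hjEu m (m - a) = 1 - (a : ℤ) := by
    rw [← hA, ← hjEu_half]
    congr 1
    omega
  have e2 : hjEu n (n - b) = 2 - (n : ℤ) := by
    rw [← hjEu_one]
    congr 1
    omega
  have e3 : hjEu (m + 2 * n) (m + 2 * n - c) = -1 := by
    rw [← hjEu_sub_two (a + b)]
    congr 1 <;> omega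
  rw [e1, e2, e3]
  have hm' : (m : ℤ) = 2 * a + 1 := by exact_mod_cast hA.symm
  have hm'' : (m : ℚ) = 2 * a + 1 := by exact_mod_cast hA.symm
  constructor
  · push_cast
    rw [hm'']
    ring
  · rw [hm']
    ring
end
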